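/- For every integer m ≥ 4, the Cartesian product W_m □ P_2 of a wheel and a path on two vertices satisfies tndi(W_m □ P_2) = m + 3 = Δ + 2, where Δ = m + 1 is its maximum degree. -/

import Mathlib

open Finset SimpleGraph

/-- A neighbor-sum-distinguishing proper total `k`-coloring of `G`:
vertex colors `cv` and edge colors `ce` taken from `{1, …, k}`, proper on
vertices, edges, and incidences, and distinguishing adjacent vertices by the
total sum of colors at each vertex. -/
def IsProperTotalColoring {V : Type*} [Fintype V] (G : SimpleGraph V) (k : ℕ)
    (cv : V → ℕ) (ce : Sym2 V → ℕ) : Prop :=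
  (∀ v, cv v ∈ Finset.Icc 1 k) ∧
  (∀ u v, G.Adj u v → ce s(u, v) ∈ Finset.Icc 1 k) ∧
  (∀ u v, G.Adj u v → cv u ≠ cv v) ∧
  (∀ u v w, G.Adj u v → G.Adj u w → v ≠ w → ce s(u, v) ≠ ce s(u, w)) ∧
  (∀ u v, G.Adj u v → ce s(u, v) ≠ cv u ∧ ce s(u, v) ≠ cv v)

open Classical in
/-- The total color-sum at a vertex: the color of `v` plus the colors of all
edges incident with `v`. -/
noncomputable def totalSum {V : Type*} [Fintype V] (G : SimpleGraph V)
    (cv : V → ℕ) (ce : Sym2 V → ℕ) (v : V) : ℕ :=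
  cv v + ∑ w ∈ Finset.univ.filter (fun w => G.Adj v w), ce s(v, w)

/-- A neighbor-sum-distinguishing proper total `k`-coloring. -/
def IsNSDColoring {V : Type*} [Fintype V] (G : SimpleGraph V) (k : ℕ)
    (cv : V → ℕ) (ce : Sym2 V → ℕ) : Prop :=
  IsProperTotalColoring G k cv ce ∧
  ∀ u v, G.Adj u v → totalSum G cv ce u ≠ totalSum G cv ce v

/-- `tndi G` is the least `k` such that `G` admits a neighbor-sum-distinguishing
proper total `k`-coloring. -/
noncomputable def tndi {V : Type*} [Fintype V] (G : SimpleGraph V) : ℕ :=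
  sInf {k | ∃ cv ce, IsNSDColoring G k cv ce}

/-- The maximum degree of a finite simple graph. -/
noncomputable def maxDeg {V : Type*} [Fintype V] (G : SimpleGraph V) : ℕ :=
  @SimpleGraph.maxDegree V G _ (Classical.decRel _)

/-- The star `S_n = K_{1,n}` with center `0` and `n` leaves. -/
def starGraph (n : ℕ) : SimpleGraph (Fin (n + 1)) :=
  SimpleGraph.fromRel fun i _ => i = 0

/-- The wheel `W_m`: hub `0` joined to every vertex of the cycle on `1, …, m`. -/
def wheelGraph (m : ℕ) : SimpleGraph (Fin (m + 1)) :=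
  SimpleGraph.fromRel fun i j =>
    i = 0 ∨ (j.val = i.val + 1 ∧ 2 ≤ j.val) ∨ (i.val = m ∧ j.val = 1)

/-! ### The lower bound -/

/-- If the colors at `v` exhaust the whole palette, then the total sum at `v` is determined. -/
theorem totalSum_eq_of_le_degree {V : Type*} [Fintype V] {G : SimpleGraph V} {k : ℕ}
    {cv : V → ℕ} {ce : Sym2 V → ℕ} (h : IsProperTotalColoring G k cv ce) (v : V)
    [DecidableRel G.Adj] (hk : k ≤ G.degree v + 1) :
    totalSum G cv ce v = ∑ c ∈ Finset.Icc 1 k, c := by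
  classical
  obtain ⟨hv, he, -, hee, hev⟩ := h
  set N := Finset.univ.filter (fun w => G.Adj v w) with hN
  have hcard : N.card = G.degree v := by
    rw [← SimpleGraph.card_neighborFinset_eq_degree]
    congr 1
    ext w
    simp [hN]
  have hinj : Set.InjOn (fun w => ce s(v, w)) N := by
    intro a ha b hb hab
    by_contra hne
    exact hee v a b (by simpa [hN] using ha) (by simpa [hN] using hb) hne hab
  have hnot : cv v ∉ N.image (fun w => ce s(v, w)) := by
    simp only [Finset.mem_image, not_exists, not_and]
    intro w hw
    exact (hev v w (by simpa [hN] using hw)).1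
  have hsub : insert (cv v) (N.image (fun w => ce s(v, w))) ⊆ Finset.Icc 1 k := by
    intro c hc
    rcases Finset.mem_insert.1 hc with rfl | hc
    · exact hv v
    · obtain ⟨w, hw, rfl⟩ := Finset.mem_image.1 hc
      exact he v w (by simpa [hN] using hw)
  have heq := Finset.eq_of_subset_of_card_le hsub (by
    rw [Finset.card_insert_of_notMem hnot, Finset.card_image_of_injOn hinj, hcard]
    simpa using hk)
  rw [← heq, Finset.sum_insert hnot, Finset.sum_image hinj, totalSum]
  congr 1
  exact Finset.sum_congr (by ext; simp [hN]) fun _ _ => rfl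

theorem wheelGraph_adj {m : ℕ} {i j : Fin (m + 1)} :
    (wheelGraph m).Adj i j ↔ i.val ≠ j.val ∧
      (i.val = 0 ∨ j.val = 0 ∨ (j.val = i.val + 1 ∧ 2 ≤ j.val) ∨ (i.val = j.val + 1 ∧ 2 ≤ i.val) ∨
        (i.val = m ∧ j.val = 1) ∨ (j.val = m ∧ i.val = 1)) := by
  simp only [wheelGraph, SimpleGraph.fromRel_adj, ne_eq, Fin.ext_iff, Fin.val_zero]
  tauto

theorem pathGraph_two_adj {x y : Fin 2} : (pathGraph 2).Adj x y ↔ x ≠ y := by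
  rw [SimpleGraph.pathGraph_adj]
  revert x y
  decide

/-- Adjacency in the prism over a wheel. -/
theorem prism_adj {m : ℕ} {u v : Fin (m + 1) × Fin 2} :
    ((wheelGraph m).boxProd (pathGraph 2)).Adj u v ↔
      ((wheelGraph m).Adj u.1 v.1 ∧ u.2 = v.2) ∨ (u.2 ≠ v.2 ∧ u.1 = v.1) := by
  rw [SimpleGraph.boxProd_adj, pathGraph_two_adj]

theorem degree_prism_le {m : ℕ} [DecidableRel ((wheelGraph m).boxProd (pathGraph 2)).Adj]
    (u : Fin (m + 1) × Fin 2) : ((wheelGraph m).boxProd (pathGraph 2)).degree u ≤ m + 1 := by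
  classical
  have h₁ := (wheelGraph m).degree_lt_card_verts u.1
  have h₂ := (pathGraph 2).degree_lt_card_verts u.2
  have h : ((wheelGraph m).boxProd (pathGraph 2)).degree u =
      (wheelGraph m).degree u.1 + (pathGraph 2).degree u.2 := by
    convert SimpleGraph.degree_boxProd (G := wheelGraph m) (H := pathGraph 2) u
  simp only [Fintype.card_fin] at h₁ h₂
  have hle := h.trans_le (show _ ≤ m + 1 by omega)
  convert hle

theorem degree_prism_hub {m : ℕ} [DecidableRel ((wheelGraph m).boxProd (pathGraph 2)).Adj]
    (x : Fin 2) : ((wheelGraph m).boxProd (pathGraph 2)).degree (0, x) = m + 1 := by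
  classical
  have h : ((wheelGraph m).boxProd (pathGraph 2)).degree (0, x) =
      (wheelGraph m).degree 0 + (pathGraph 2).degree x := by
    convert SimpleGraph.degree_boxProd (G := wheelGraph m) (H := pathGraph 2) (0, x)
  have h₁ : (wheelGraph m).degree 0 = m := by
    rw [← SimpleGraph.card_neighborFinset_eq_degree]
    have : (wheelGraph m).neighborFinset 0 = Finset.univ.erase 0 := by
      ext j
      have hj : j ≠ 0 ↔ 0 ≠ j.val := by rw [ne_comm, ne_eq, Fin.ext_iff, Fin.val_zero]
      rw [SimpleGraph.mem_neighborFinset, wheelGraph_adj, Finset.mem_erase, hj, Fin.val_zero]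
      simp
    simp [this]
  have h₂ : (pathGraph 2).degree x = 1 := by
    rw [← SimpleGraph.card_neighborFinset_eq_degree]
    have : (pathGraph 2).neighborFinset x = Finset.univ.erase x := by
      ext y
      simp [pathGraph_two_adj, eq_comm]
    simp [this]
  rw [h₁, h₂] at h
  convert h

theorem maxDeg_prism (m : ℕ) : maxDeg ((wheelGraph m).boxProd (pathGraph 2)) = m + 1 := by
  classical
  unfold maxDeg
  apply le_antisymm
  · exact SimpleGraph.maxDegree_le_of_forall_degree_le _ _ fun u => degree_prism_le u
  · exact (degree_prism_hub 0).ge.trans (SimpleGraph.degree_le_maxDegree _ (0, 0))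

theorem le_of_isNSDColoring_prism {m k : ℕ} {cv : Fin (m + 1) × Fin 2 → ℕ}
    {ce : Sym2 (Fin (m + 1) × Fin 2) → ℕ}
    (h : IsNSDColoring ((wheelGraph m).boxProd (pathGraph 2)) k cv ce) : m + 3 ≤ k := by
  classical
  by_contra! hk
  have hsum (x : Fin 2) := totalSum_eq_of_le_degree h.1 ((0 : Fin (m + 1)), x)
    (by rw [degree_prism_hub]; omega)
  exact h.2 (0, 0) (0, 1) (prism_adj.2 (Or.inr ⟨by simp, rfl⟩)) ((hsum 0).trans (hsum 1).symm)

/-! ### The coloring -/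

/-- The color of the spoke to rim vertex `i` in copy `x` of the wheel. -/
def spokeColor (m x i : ℕ) : ℕ :=
  if x = 0 then i + 3 else if i = m then 4 else i + 4

/-- The color of the rim edge between `i < j`, the same in both copies of the wheel. -/
def rimColor (m i j : ℕ) : ℕ :=
  if i = 1 ∧ j = m then (if m % 2 = 0 then 2 else 7) else if i % 2 = 1 then 1 else 2

/-- The color of vertex `i` in copy `x` of the wheel. -/
def vertexColor (m x i : ℕ) : ℕ :=
  if x = 0 then
    if i = 0 then 1 else if i = m then 4 else i + 4
  else
    if i = 0 then 2 else if i = m then 5 else if i + 1 = m then 4 else i + 5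

/-- The color of the edge joining `i` and `j` within copy `x` of the wheel. -/
def wheelEdgeColor (m x i j : ℕ) : ℕ :=
  if min i j = 0 then spokeColor m x (max i j) else rimColor m (min i j) (max i j)

/-- The vertex coloring of the prism. -/
def prismVertexColor (m : ℕ) (u : Fin (m + 1) × Fin 2) : ℕ :=
  vertexColor m u.2 u.1

/-- The edge coloring of the prism; all rungs have color `3`. -/
def prismEdgeColor (m : ℕ) : Sym2 (Fin (m + 1) × Fin 2) → ℕ :=
  Sym2.lift ⟨fun u v => if u.2 = v.2 then wheelEdgeColor m u.2 u.1 v.1 else 3, by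
    intro u v
    by_cases h : u.2 = v.2
    · simp [h, wheelEdgeColor, min_comm, max_comm]
    · simp [h, Ne.symm h]⟩

theorem prismEdgeColor_mk (m : ℕ) (u v : Fin (m + 1) × Fin 2) :
    prismEdgeColor m s(u, v) = if u.2 = v.2 then wheelEdgeColor m u.2 u.1 v.1 else 3 :=
  rfl

theorem spokeColor_inj {m x i j : ℕ} (hi : 1 ≤ i) (hj : 1 ≤ j)
    (h : spokeColor m x i = spokeColor m x j) : i = j := by
  unfold spokeColor at h
  split_ifs at h <;> omega

theorem wheelEdgeColor_zero_left (m x j : ℕ) :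
    wheelEdgeColor m x 0 j = spokeColor m x j := by
  simp [wheelEdgeColor]

theorem wheelEdgeColor_zero_right (m x i : ℕ) :
    wheelEdgeColor m x i 0 = spokeColor m x i := by
  simp [wheelEdgeColor]

/-- The neighbors of a rim vertex within its wheel. -/
theorem wheelGraph_adj_rim {m : ℕ} (hm : 4 ≤ m) {i j : Fin (m + 1)} (hi : i.val ≠ 0) :
    (wheelGraph m).Adj i j ↔ j.val = 0 ∨ j.val = (if i.val = 1 then m else i.val - 1) ∨
      j.val = (if i.val = m then 1 else i.val + 1) := by
  rw [wheelGraph_adj]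
  have := i.2
  have := j.2
  split_ifs <;> omega

/-- The color of the rim edge from `i` to its predecessor. -/
theorem wheelEdgeColor_pred {m x i : ℕ} (hm : 4 ≤ m) (hi : i ≠ 0) :
    wheelEdgeColor m x i (if i = 1 then m else i - 1) =
      if i = 1 then (if m % 2 = 0 then 2 else 7) else if i % 2 = 0 then 1 else 2 := by
  unfold wheelEdgeColor rimColor
  split_ifs <;> omega

/-- The color of the rim edge from `i` to its successor. -/
theorem wheelEdgeColor_succ {m x i : ℕ} (hm : 4 ≤ m) (hi : i ≠ 0) (him : i ≤ m) :
    wheelEdgeColor m x i (if i = m then 1 else i + 1) =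
      if i = m then (if m % 2 = 0 then 2 else 7) else if i % 2 = 1 then 1 else 2 := by
  unfold wheelEdgeColor rimColor
  split_ifs <;> omega

theorem wheelEdgeColor_mem {m x : ℕ} (hm : 4 ≤ m) {i j : Fin (m + 1)}
    (h : (wheelGraph m).Adj i j) :
    wheelEdgeColor m x i j ∈ Finset.Icc 1 (m + 3) ∧ wheelEdgeColor m x i j ≠ 3 := by
  rw [wheelGraph_adj] at h
  have := i.2
  have := j.2
  rw [Finset.mem_Icc]
  unfold wheelEdgeColor rimColor spokeColor
  split_ifs <;> omega

theorem wheelEdgeColor_ne_vertexColor {m x : ℕ} (hm : 4 ≤ m) {i j : Fin (m + 1)}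
    (h : (wheelGraph m).Adj i j) : wheelEdgeColor m x i j ≠ vertexColor m x i := by
  have := i.2
  have := j.2
  by_cases hi : i.val = 0
  · rw [wheelGraph_adj] at h
    rw [hi, wheelEdgeColor_zero_left]
    unfold vertexColor spokeColor
    split_ifs <;> omega
  · rcases (wheelGraph_adj_rim hm hi).1 h with hj | hj | hj <;> rw [hj]
    · rw [wheelEdgeColor_zero_right]
      unfold vertexColor spokeColor
      split_ifs <;> omega
    · rw [wheelEdgeColor_pred hm hi]
      unfold vertexColor
      split_ifs <;> omega
    · rw [wheelEdgeColor_succ hm hi (by omega)]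
      unfold vertexColor
      split_ifs <;> omega

theorem wheelEdgeColor_ne {m x : ℕ} (hm : 4 ≤ m) {i j l : Fin (m + 1)}
    (hj : (wheelGraph m).Adj i j) (hl : (wheelGraph m).Adj i l) (hjl : j ≠ l) :
    wheelEdgeColor m x i j ≠ wheelEdgeColor m x i l := by
  have := i.2
  have hjl' := Fin.val_ne_of_ne hjl
  by_cases hi : i.val = 0
  · rw [wheelGraph_adj] at hj hl
    rw [hi, wheelEdgeColor_zero_left, wheelEdgeColor_zero_left]
    exact fun h => hjl' (spokeColor_inj (by omega) (by omega) h)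
  · have hs := @wheelEdgeColor_zero_right m x i.val
    have hp := @wheelEdgeColor_pred m x i.val hm hi
    have hn := @wheelEdgeColor_succ m x i.val hm hi (by omega)
    rcases (wheelGraph_adj_rim hm hi).1 hj with h | h | h <;>
    rcases (wheelGraph_adj_rim hm hi).1 hl with h' | h' | h' <;>
    first
    | exact absurd (h.trans h'.symm) hjl'
    | rw [h, h']
      simp only [hs, hp, hn]
      try unfold spokeColor
      split_ifs <;> omega

theorem vertexColor_ne {m x : ℕ} (hm : 4 ≤ m) {i j : Fin (m + 1)}
    (h : (wheelGraph m).Adj i j) : vertexColor m x i ≠ vertexColor m x j := by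
  rw [wheelGraph_adj] at h
  have := i.2
  have := j.2
  unfold vertexColor
  split_ifs <;> omega

theorem prismColoring_proper {m : ℕ} (hm : 4 ≤ m) :
    IsProperTotalColoring ((wheelGraph m).boxProd (pathGraph 2)) (m + 3)
      (prismVertexColor m) (prismEdgeColor m) := by
  have hvertex (u) : prismVertexColor m u ∈ Finset.Icc 1 (m + 3) ∧ prismVertexColor m u ≠ 3 := by
    have := u.1.2
    rw [Finset.mem_Icc]
    unfold prismVertexColor vertexColor
    split_ifs <;> omega
  have hinc (u v) (h : ((wheelGraph m).boxProd (pathGraph 2)).Adj u v) :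
      prismEdgeColor m s(u, v) ≠ prismVertexColor m u := by
    rw [prismEdgeColor_mk]
    rcases prism_adj.1 h with ⟨h, hx⟩ | ⟨hx, -⟩
    · rw [if_pos hx]
      exact wheelEdgeColor_ne_vertexColor hm h
    · rw [if_neg hx]
      exact (hvertex u).2.symm
  refine ⟨fun u => (hvertex u).1, ?_, ?_, ?_, ?_⟩
  · intro u v h
    rw [prismEdgeColor_mk]
    rcases prism_adj.1 h with ⟨h, hx⟩ | ⟨hx, -⟩
    · rw [if_pos hx]
      exact (wheelEdgeColor_mem hm h).1
    · rw [if_neg hx]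
      simp
  · intro u v h
    unfold prismVertexColor
    rcases prism_adj.1 h with ⟨h, hx⟩ | ⟨hx, h⟩
    · rw [hx]
      exact vertexColor_ne hm h
    · have := Fin.val_ne_of_ne hx
      have := u.2.2
      have := v.2.2
      rw [h]
      unfold vertexColor
      split_ifs <;> omega
  · intro u v w hv hw hne
    rw [prismEdgeColor_mk, prismEdgeColor_mk]
    rcases prism_adj.1 hv with ⟨hv, hx⟩ | ⟨hx, hv⟩ <;>
    rcases prism_adj.1 hw with ⟨hw, hy⟩ | ⟨hy, hw⟩
    · rw [if_pos hx, if_pos hy]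
      exact wheelEdgeColor_ne hm hv hw fun h => hne (Prod.ext h (hx.symm.trans hy))
    · rw [if_pos hx, if_neg hy]
      exact (wheelEdgeColor_mem hm hv).2
    · rw [if_neg hx, if_pos hy]
      exact (wheelEdgeColor_mem hm hw).2.symm
    · refine absurd (Prod.ext (hv.symm.trans hw) ?_) hne
      omega
  · intro u v h
    refine ⟨hinc u v h, ?_⟩
    rw [Sym2.eq_swap]
    exact hinc v u h.symm

/-! ### The total sums of the coloring -/

/-- The spoke colors of either copy are `4, …, m + 3`. -/
theorem sum_spokeColor (m x : ℕ) :
    ∑ j : Fin m, spokeColor m x (j + 1) = ∑ j ∈ Finset.range m, (j + 4) := by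
  rw [Fin.sum_univ_eq_sum_range (fun j => spokeColor m x (j + 1))]
  by_cases hx : x = 0
  · simp [spokeColor, hx]
  · cases m with
    | zero => rfl
    | succ n =>
      rw [Finset.sum_range_succ, Finset.sum_range_succ' (fun j => j + 4)]
      simp only [spokeColor, hx, if_true, if_false]
      congr 1
      refine Finset.sum_congr rfl fun j hj => ?_
      rw [Finset.mem_range] at hj
      rw [if_neg (by omega)]

theorem totalSum_prism_hub (m : ℕ) (x : Fin 2) :
    totalSum ((wheelGraph m).boxProd (pathGraph 2)) (prismVertexColor m) (prismEdgeColor m)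
      (0, x) = x + 4 + ∑ j ∈ Finset.range m, (j + 4) := by
  classical
  have hx : x = 0 ∨ x = 1 := by omega
  have h₁ := sum_spokeColor m x
  simp only [totalSum, Finset.sum_filter, Fintype.sum_prod_type, Fin.sum_univ_two,
    Fin.sum_univ_succ (n := m), prismEdgeColor_mk, prism_adj, wheelGraph_adj]
  rcases hx with rfl | rfl <;>
  simp [wheelEdgeColor_zero_left, prismVertexColor, vertexColor, eq_comm] at h₁ ⊢ <;> omega

/-- The total sum at rim vertex `i` in copy `x`. -/
def rimSum (m x i : ℕ) : ℕ :=
  vertexColor m x i + (3 + (spokeColor m x i +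
    ((if i = 1 then (if m % 2 = 0 then 2 else 7) else if i % 2 = 0 then 1 else 2) +
      if i = m then (if m % 2 = 0 then 2 else 7) else if i % 2 = 1 then 1 else 2)))

theorem totalSum_prism_rim {m : ℕ} (hm : 4 ≤ m) {i : Fin (m + 1)} (hi : i.val ≠ 0) (x : Fin 2) :
    totalSum ((wheelGraph m).boxProd (pathGraph 2)) (prismVertexColor m) (prismEdgeColor m)
      (i, x) = rimSum m x i := by
  classical
  have him := i.2
  have hp : (if i.val = 1 then m else i.val - 1) < m + 1 := by split_ifs <;> omega
  have hn : (if i.val = m then 1 else i.val + 1) < m + 1 := by split_ifs <;> omega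
  set p : Fin (m + 1) := ⟨_, hp⟩ with hp_def
  set n : Fin (m + 1) := ⟨_, hn⟩ with hn_def
  have hN : Finset.univ.filter (((wheelGraph m).boxProd (pathGraph 2)).Adj (i, x)) =
      {(i, 1 - x), (0, x), (p, x), (n, x)} := by
    ext ⟨j, y⟩
    have hxy : x ≠ y ↔ y = 1 - x := by revert x y; decide
    have hji : i = j ↔ j = i := eq_comm
    have hyx : x = y ↔ y = x := eq_comm
    simp only [Finset.mem_filter, Finset.mem_univ, true_and, prism_adj,
      wheelGraph_adj_rim hm hi, hxy, Finset.mem_insert, Finset.mem_singleton, Prod.mk.injEq,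
      hji, hyx, hp_def, hn_def, Fin.ext_iff (a := j) (b := 0),
      Fin.ext_iff (a := j) (b := ⟨_, hp⟩), Fin.ext_iff (a := j) (b := ⟨_, hn⟩), Fin.val_zero]
    tauto
  have hx : x ≠ 1 - x := by clear hN; revert x; decide
  have hp0 : 0 ≠ p := by
    refine fun h => ?_
    have h := congrArg Fin.val h
    simp only [hp_def, Fin.val_zero] at h
    split_ifs at h <;> omega
  have hn0 : 0 ≠ n := by
    refine fun h => ?_
    have h := congrArg Fin.val h
    simp only [hn_def, Fin.val_zero] at h
    split_ifs at h
  have hpn : p ≠ n := by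
    refine fun h => ?_
    have h := congrArg Fin.val h
    simp only [hp_def, hn_def] at h
    split_ifs at h <;> omega
  have hcp := @wheelEdgeColor_pred m x i hm hi
  have hcn := @wheelEdgeColor_succ m x i hm hi (by omega)
  rw [totalSum]
  simp only [hN]
  rw [Finset.sum_insert (by simp [hx.symm]), Finset.sum_insert (by simp [hp0, hn0]),
    Finset.sum_insert (by simp [hpn]), Finset.sum_singleton]
  simp only [prismEdgeColor_mk, if_true, hx, if_false, Fin.val_zero, wheelEdgeColor_zero_right,
    hp_def, hn_def, hcp, hcn]
  rfl

theorem rimSum_lt_hub {m x i : ℕ} (hm : 4 ≤ m) (hi : i ≠ 0) (him : i ≤ m) :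
    rimSum m x i < 4 + ∑ j ∈ Finset.range m, (j + 4) := by
  have hsum (n : ℕ) (hn : 5 ≤ n) : 2 * n + 15 ≤ ∑ j ∈ Finset.range n, (j + 4) := by
    induction n, hn using Nat.le_induction with
    | base => decide
    | succ n hn ih =>
      rw [Finset.sum_range_succ]
      omega
  rcases hm.eq_or_lt with rfl | hm'
  · rw [show ∑ j ∈ Finset.range 4, (j + 4) = 22 from rfl]
    unfold rimSum vertexColor spokeColor
    split_ifs <;> omega
  · have := hsum m hm'
    unfold rimSum vertexColor spokeColor
    split_ifs <;> omega

theorem rimSum_ne_of_adj {m x : ℕ} (hm : 4 ≤ m) {i j : Fin (m + 1)} (hi : i.val ≠ 0)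
    (hj : j.val ≠ 0) (h : (wheelGraph m).Adj i j) : rimSum m x i ≠ rimSum m x j := by
  have hsucc (l : ℕ) (hl : l ≠ 0) (hlm : l < m) : rimSum m x l ≠ rimSum m x (l + 1) := by
    unfold rimSum vertexColor spokeColor
    by_cases hx : x = 0
    · simp only [hx, if_true]
      grind
    · simp only [hx, if_false]
      grind
  have hlast : rimSum m x m ≠ rimSum m x 1 := by
    unfold rimSum vertexColor spokeColor
    grind
  have := i.2
  have := j.2
  rw [wheelGraph_adj] at h
  rcases h.2 with h | h | h | h | h | h
  · exact absurd h hi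
  · exact absurd h hj
  · rw [h.1]
    exact hsucc i hi (by omega)
  · rw [h.1]
    exact (hsucc j hj (by omega)).symm
  · rw [h.1, h.2]
    exact hlast
  · rw [h.1, h.2]
    exact hlast.symm

theorem rimSum_zero_ne_one {m : ℕ} (hm : 4 ≤ m) (i : ℕ) :
    rimSum m 0 i ≠ rimSum m 1 i := by
  simp only [rimSum, vertexColor, spokeColor, if_true, one_ne_zero, if_false]
  split_ifs <;> omega

theorem isNSDColoring_prism {m : ℕ} (hm : 4 ≤ m) :
    IsNSDColoring ((wheelGraph m).boxProd (pathGraph 2)) (m + 3)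
      (prismVertexColor m) (prismEdgeColor m) := by
  refine ⟨prismColoring_proper hm, ?_⟩
  have hhub (i : Fin (m + 1)) (hi : i.val ≠ 0) (x y : Fin 2) :
      totalSum ((wheelGraph m).boxProd (pathGraph 2)) (prismVertexColor m) (prismEdgeColor m)
        (i, x) <
      totalSum ((wheelGraph m).boxProd (pathGraph 2)) (prismVertexColor m) (prismEdgeColor m)
        (0, y) := by
    rw [totalSum_prism_rim hm hi, totalSum_prism_hub]
    have := @rimSum_lt_hub m x i hm hi (by omega)
    omega
  rintro ⟨i, x⟩ ⟨j, y⟩ h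
  rcases prism_adj.1 h with ⟨h, hxy⟩ | ⟨hxy, h⟩
  · obtain rfl : x = y := hxy
    simp only at h
    by_cases hi : i.val = 0
    · obtain rfl : i = 0 := Fin.ext hi
      refine (hhub j (fun hj => ?_) x x).ne'
      exact h.ne (Fin.ext hj).symm
    · by_cases hj : j.val = 0
      · obtain rfl : j = 0 := Fin.ext hj
        exact (hhub i hi x x).ne
      · rw [totalSum_prism_rim hm hi, totalSum_prism_rim hm hj]
        exact rimSum_ne_of_adj hm hi hj h
  · obtain rfl : i = j := h
    have hxy : x ≠ y := hxy
    by_cases hi : i.val = 0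
    · obtain rfl : i = 0 := Fin.ext hi
      rw [totalSum_prism_hub, totalSum_prism_hub]
      have := Fin.val_ne_of_ne hxy
      omega
    · rw [totalSum_prism_rim hm hi, totalSum_prism_rim hm hi]
      have h01 := rimSum_zero_ne_one hm i
      have : (x = 0 ∧ y = 1) ∨ (x = 1 ∧ y = 0) := by omega
      rcases this with ⟨rfl, rfl⟩ | ⟨rfl, rfl⟩
      · exact h01
      · exact h01.symm

theorem stmt_19 (m : ℕ) (hm : 4 ≤ m) :
    maxDeg ((wheelGraph m).boxProd (pathGraph 2)) = m + 1 ∧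
    tndi ((wheelGraph m).boxProd (pathGraph 2)) = m + 3 := by
  refine ⟨maxDeg_prism m, le_antisymm ?_ ?_⟩
  · exact Nat.sInf_le ⟨_, _, isNSDColoring_prism hm⟩
  · refine le_csInf ⟨_, _, _, isNSDColoring_prism hm⟩ ?_
    rintro k ⟨cv, ce, h⟩
    exact le_of_isNSDColoring_prism h
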